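/- arXiv:2509.20902 — 12 statements merged into one kernel-verified Lean document; each statement's English description precedes it below -/
import Mathlib

section
/- Let E be a real normed space and f : E → ℝ be Fréchet differentiable. Let t > 0 and let μ₁ : [0, t] → ℝ be nondecreasing and integrable such that ‖f'(x) − f'(y)‖ ≤ μ₁(τ) whenever x, y ∈ E satisfy ‖x − y‖ ≤ τ ≤ t. Then for all x, y ∈ E with ‖x − y‖ ≤ t and all α ∈ (0,1), |α f(x) + (1−α) f(y) − f(α x + (1−α) y)| ≤ α(1−α) ∫₀^t μ₁(τ) dτ. -/
theorem stmt_1 {E : Type*} [NormedAddCommGroup E] [NormedSpace ℝ E]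
    (f : E → ℝ) (f' : E → E →L[ℝ] ℝ) (hf : ∀ x, HasFDerivAt f (f' x) x)
    (t : ℝ) (ht : 0 < t) (μ₁ : ℝ → ℝ)
    (hmono : MonotoneOn μ₁ (Set.Icc 0 t))
    (hint : IntervalIntegrable μ₁ MeasureTheory.volume 0 t)
    (hbound : ∀ x y : E, ∀ τ : ℝ, ‖x - y‖ ≤ τ → τ ≤ t → ‖f' x - f' y‖ ≤ μ₁ τ) :
    ∀ x y : E, ‖x - y‖ ≤ t → ∀ α ∈ Set.Ioo (0:ℝ) 1,
      |α * f x + (1 - α) * f y - f (α • x + (1 - α) • y)|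
        ≤ α * (1 - α) * ∫ τ in (0:ℝ)..t, μ₁ τ := by
  intro x y hxy α hα
  have hc : 0 < α * (1 - α) := mul_pos hα.1 (sub_pos.2 hα.2)
  set z := α • x + (1 - α) • y with hz
  let p : ℝ → ℝ → E := fun c s => z + s • c • (x - y)
  have hp : ∀ c s, HasDerivAt (fun s => f (p c s)) (f' (p c s) (c • (x - y))) s := fun c s => by
    have hline : HasDerivAt (p c) (c • (x - y)) s := by
      simpa [p] using ((hasDerivAt_id s).smul_const (c • (x - y))).const_add z
    exact (hf (p c s)).comp_hasDerivAt s hline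
  have hdist : ∀ s, p (1 - α) s - p (-α) s = s • (x - y) := fun s => by
    simp only [p]; module
  have hderiv : ∀ s, HasDerivAt (fun s => α * f (p (1 - α) s) + (1 - α) * f (p (-α) s))
      (α * (1 - α) * (f' (p (1 - α) s) - f' (p (-α) s)) (x - y)) s := fun s => by
    refine (((hp (1 - α) s).const_mul α).add ((hp (-α) s).const_mul (1 - α))).congr_deriv ?_
    simp only [map_smul, smul_eq_mul, sub_apply]
    ring
  have hle : ∀ s ∈ Set.Ioo (0 : ℝ) 1,
      |α * (1 - α) * (f' (p (1 - α) s) - f' (p (-α) s)) (x - y)| ≤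
        α * (1 - α) * (t * μ₁ (t * s)) := fun s hs => by
    have hμ : ‖f' (p (1 - α) s) - f' (p (-α) s)‖ ≤ μ₁ (t * s) := by
      refine hbound _ _ _ ?_ (mul_le_of_le_one_right ht.le hs.2.le)
      rw [hdist, norm_smul, Real.norm_of_nonneg hs.1.le, mul_comm]
      exact mul_le_mul_of_nonneg_right hxy hs.1.le
    rw [abs_mul, abs_of_pos hc, mul_comm t]
    refine mul_le_mul_of_nonneg_left ?_ hc.le
    exact (ContinuousLinearMap.le_opNorm _ _).trans
      (mul_le_mul hμ hxy (norm_nonneg _) ((norm_nonneg _).trans hμ))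
  have hintegrable : IntervalIntegrable (fun s => α * (1 - α) * (t * μ₁ (t * s)))
      MeasureTheory.volume 0 1 := by
    have hscaled := hint.comp_mul_left (c := t)
    rw [zero_div, div_self ht.ne'] at hscaled
    exact (hscaled.const_mul t).const_mul _
  have key := norm_sub_le_integral_of_norm_deriv_le_of_le zero_le_one
    (fun s _ => (hderiv s).continuousAt.continuousWithinAt)
    (fun s _ => (hderiv s).differentiableAt.differentiableWithinAt)
    (.of_forall fun s hs => (hderiv s).deriv ▸ hle s hs) hintegrable
  have hx : p (1 - α) 1 = x := by simp only [p, hz]; module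
  have hy : p (-α) 1 = y := by simp only [p, hz]; module
  have h0 : ∀ c, p c 0 = z := fun c => by simp [p]
  rw [Real.norm_eq_abs, intervalIntegral.integral_const_mul, intervalIntegral.integral_const_mul,
    intervalIntegral.mul_integral_comp_mul_left, mul_zero, mul_one, hx, hy, h0, h0] at key
  convert key using 2
  ring
end

section
/- Let E be a real normed space, D ⊆ E a convex set, f : D → ℝ, T > 0, and μ : [0, T] → ℝ such that for every t ∈ [0, T]: (a) for all x, y ∈ D with ‖x − y‖ ≤ t and all α ∈ (0,1), |α f(x) + (1−α) f(y) − f(α x + (1−α) y)| ≤ α(1−α) μ(t); and (b) for every ε > 0 there exist x, y ∈ D with ‖x − y‖ ≤ t and α ∈ (0,1) such that |α f(x) + (1−α) f(y) − f(α x + (1−α) y)| ≥ α(1−α)(μ(t) − ε). Then for every t ∈ [0, T] and every β ∈ [0,1], μ(β t) ≥ β² μ(t). -/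
/-- If every interval `[u, u + β] ⊆ [0, 1]` with `1 / 2 < β` satisfies the chord bound with
constant `M`, then `[0, 1]` satisfies it with constant `M / β ^ 2`. -/
theorem sq_mul_chord_sub_le {φ : ℝ → ℝ} {β M : ℝ} (hβ : 1 / 2 < β) (hβ1 : β ≤ 1)
    (h : ∀ u, 0 ≤ u → u + β ≤ 1 → ∀ l ∈ Set.Ioo (0:ℝ) 1,
      l * φ (u + β) + (1 - l) * φ u - φ (u + l * β) ≤ l * (1 - l) * M)
    {α : ℝ} (hα : α ∈ Set.Ioo (0:ℝ) 1) :
    β ^ 2 * (α * φ 1 + (1 - α) * φ 0 - φ α) ≤ α * (1 - α) * M := by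
  have hβ0 : 0 < β := by linarith
  obtain ⟨K, rfl⟩ : ∃ K, M = K * β ^ 2 := ⟨M / β ^ 2, by field_simp⟩
  obtain ⟨e, he⟩ : ∃ e : ℝ → ℝ, ∀ s, e s = s * φ 1 + (1 - s) * φ 0 - φ s - s * (1 - s) * K :=
    ⟨_, fun _ => rfl⟩
  have e0 : e 0 = 0 := by rw [he]; ring
  have e1 : e 1 = 0 := by rw [he]; ring
  have conv : ∀ u, 0 ≤ u → u + β ≤ 1 → ∀ w, u < w → w < u + β →
      e w ≤ (w - u) / β * e (u + β) + (1 - (w - u) / β) * e u := by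
    intro u hu huβ w huw hwu
    obtain ⟨l, rfl⟩ : ∃ l, w = u + l * β := ⟨(w - u) / β, by field_simp; ring⟩
    have hl : (u + l * β - u) / β = l := by field_simp; ring
    have hl0 : 0 < l := by by_contra hc; nlinarith
    have hl1 : l < 1 := by by_contra hc; nlinarith
    have := h u hu huβ l ⟨hl0, hl1⟩
    rw [hl, he, he, he]
    linarith
  have key : e (1 - β) ≤ 0 ∧ e β ≤ 0 := by
    rcases hβ1.eq_or_lt with rfl | hlt
    · simp [e0, e1]
    have h1 := conv 0 le_rfl (by linarith) (1 - β) (by linarith) (by linarith)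
    have h2 := conv (1 - β) (by linarith) (by linarith) β (by linarith) (by linarith)
    rw [e0, zero_add] at h1
    rw [sub_add_cancel, e1] at h2
    have hc : 1 - (β - (1 - β)) / β = (1 - β) / β := by field_simp; ring
    rw [hc] at h2
    rw [sub_zero] at h1
    have c0 : 0 < (1 - β) / β := div_pos (by linarith) hβ0
    have c1 : (1 - β) / β < 1 := by rw [div_lt_one hβ0]; linarith
    generalize (1 - β) / β = c at *
    have hn : e (1 - β) ≤ 0 := by
      by_contra hc
      have : c * e β ≤ c * (c * e (1 - β)) := mul_le_mul_of_nonneg_left (by linarith) c0.le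
      have : c * c < 1 := by nlinarith
      nlinarith
    exact ⟨hn, by nlinarith⟩
  have eα : e α ≤ 0 := by
    obtain ⟨hα0, hα1⟩ := hα
    rcases lt_or_ge α β with hlt | hge
    · have h1 := conv 0 le_rfl (by linarith) α hα0 (by linarith)
      rw [e0, zero_add, sub_zero] at h1
      have : 0 < α / β := by positivity
      nlinarith [key.2]
    · have h2 := conv (1 - β) (by linarith) (by linarith) α (by linarith) (by linarith)
      rw [sub_add_cancel, e1] at h2
      have : (α - (1 - β)) / β ≤ 1 := by rw [div_le_one hβ0]; linarith
      nlinarith [key.1]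
  rw [he] at eα
  nlinarith [mul_nonneg (sq_nonneg β) (neg_nonneg.2 eα)]

/-- Global curvature bound on short segments controls long ones, when the ratio of the lengths
exceeds `1 / 2`. -/
theorem sq_mul_abs_chord_sub_le {E : Type*} [NormedAddCommGroup E] [NormedSpace ℝ E]
    {D : Set E} (hD : Convex ℝ D) {f : E → ℝ} {t β M : ℝ} (hβ : 1 / 2 < β) (hβ1 : β ≤ 1)
    (h : ∀ x ∈ D, ∀ y ∈ D, ‖x - y‖ ≤ β * t → ∀ α ∈ Set.Ioo (0:ℝ) 1,
      |α * f x + (1 - α) * f y - f (α • x + (1 - α) • y)| ≤ α * (1 - α) * M)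
    {x y : E} (hx : x ∈ D) (hy : y ∈ D) (hxy : ‖x - y‖ ≤ t) {α : ℝ}
    (hα : α ∈ Set.Ioo (0:ℝ) 1) :
    β ^ 2 * |α * f x + (1 - α) * f y - f (α • x + (1 - α) • y)| ≤ α * (1 - α) * M := by
  obtain ⟨φ, hφ⟩ : ∃ φ : ℝ → ℝ, ∀ s, φ s = f (s • x + (1 - s) • y) := ⟨_, fun _ => rfl⟩
  have H : ∀ u, 0 ≤ u → u + β ≤ 1 → ∀ l ∈ Set.Ioo (0:ℝ) 1,
      |l * φ (u + β) + (1 - l) * φ u - φ (u + l * β)| ≤ l * (1 - l) * M := by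
    intro u hu huβ l hl
    have mem : ∀ s : ℝ, 0 ≤ s → s ≤ 1 → s • x + (1 - s) • y ∈ D := fun s h0 h1 =>
      hD hx hy h0 (by linarith) (by ring)
    have hdist : ‖((u + β) • x + (1 - (u + β)) • y) - (u • x + (1 - u) • y)‖ ≤ β * t := by
      have : ((u + β) • x + (1 - (u + β)) • y) - (u • x + (1 - u) • y) = β • (x - y) := by
        module
      rw [this, norm_smul, Real.norm_of_nonneg (by linarith)]
      exact mul_le_mul_of_nonneg_left hxy (by linarith)
    have := h _ (mem (u + β) (by linarith) huβ) _ (mem u hu (by linarith)) hdist l hl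
    have hw : l • ((u + β) • x + (1 - (u + β)) • y) + (1 - l) • (u • x + (1 - u) • y)
        = (u + l * β) • x + (1 - (u + l * β)) • y := by module
    rwa [hw, ← hφ, ← hφ, ← hφ] at this
  have up := sq_mul_chord_sub_le hβ hβ1
    (fun u hu huβ l hl => (abs_le.1 (H u hu huβ l hl)).2) hα
  have down := sq_mul_chord_sub_le (φ := fun s => -φ s) hβ hβ1
    (fun u hu huβ l hl => by linarith [(abs_le.1 (H u hu huβ l hl)).1]) hα
  have φ1 : φ 1 = f x := by simp [hφ]
  have φ0 : φ 0 = f y := by simp [hφ]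
  rw [← hφ, ← φ1, ← φ0, ← abs_of_nonneg (sq_nonneg β), ← abs_mul, abs_le]
  exact ⟨by linarith, up⟩

theorem stmt_2 {E : Type*} [NormedAddCommGroup E] [NormedSpace ℝ E]
    (D : Set E) (hD : Convex ℝ D) (f : E → ℝ) (T : ℝ) (hT : 0 < T) (μ : ℝ → ℝ)
    (ha : ∀ t ∈ Set.Icc (0:ℝ) T, ∀ x ∈ D, ∀ y ∈ D, ‖x - y‖ ≤ t →
      ∀ α ∈ Set.Ioo (0:ℝ) 1,
        |α * f x + (1 - α) * f y - f (α • x + (1 - α) • y)| ≤ α * (1 - α) * μ t)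
    (hb : ∀ t ∈ Set.Icc (0:ℝ) T, ∀ ε > (0:ℝ), ∃ x ∈ D, ∃ y ∈ D, ‖x - y‖ ≤ t ∧
      ∃ α ∈ Set.Ioo (0:ℝ) 1,
        α * (1 - α) * (μ t - ε) ≤ |α * f x + (1 - α) * f y - f (α • x + (1 - α) • y)|) :
    ∀ t ∈ Set.Icc (0:ℝ) T, ∀ β ∈ Set.Icc (0:ℝ) 1, β^2 * μ t ≤ μ (β * t) := by
  have step : ∀ t ∈ Set.Icc (0:ℝ) T, ∀ β, 1 / 2 < β → β ≤ 1 → β ^ 2 * μ t ≤ μ (β * t) := by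
    intro t ht β hβ hβ1
    have hβt : β * t ∈ Set.Icc (0:ℝ) T :=
      ⟨mul_nonneg (by linarith) ht.1, by nlinarith [ht.1, ht.2]⟩
    refine le_of_forall_pos_le_add fun ε hε => ?_
    obtain ⟨x, hx, y, hy, hxy, α, hα, hle⟩ := hb t ht ε hε
    have hbound := sq_mul_abs_chord_sub_le hD hβ hβ1 (ha _ hβt) hx hy hxy hα
    have hα' : 0 < α * (1 - α) := mul_pos hα.1 (by linarith [hα.2])
    have h1 : α * (1 - α) * (β ^ 2 * (μ t - ε)) ≤ α * (1 - α) * μ (β * t) := by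
      nlinarith [mul_le_mul_of_nonneg_left hle (sq_nonneg β)]
    have h2 := le_of_mul_le_mul_left h1 hα'
    have h3 : β ^ 2 ≤ 1 := by nlinarith
    nlinarith
  have iter : ∀ n : ℕ, ∀ t ∈ Set.Icc (0:ℝ) T, ∀ β, (2 / 3 : ℝ) ^ n ≤ β → β ≤ 1 →
      β ^ 2 * μ t ≤ μ (β * t) := by
    intro n
    induction n with
    | zero =>
      intro t ht β hβ hβ1
      exact step t ht β (by norm_num at hβ; linarith) hβ1
    | succ n ih =>
      intro t ht β hβ hβ1
      rcases lt_or_ge (1 / 2) β with hlt | hge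
      · exact step t ht β hlt hβ1
      · have hpos : 0 < β := lt_of_lt_of_le (by positivity) hβ
        have h1 := ih t ht (3 / 2 * β) (by rw [pow_succ] at hβ; linarith) (by linarith)
        have hmem : 3 / 2 * β * t ∈ Set.Icc (0:ℝ) T :=
          ⟨mul_nonneg (by linarith) ht.1, by nlinarith [ht.1, ht.2]⟩
        have h2 := step _ hmem (2 / 3) (by norm_num) (by norm_num)
        rw [show 2 / 3 * (3 / 2 * β * t) = β * t by ring] at h2
        nlinarith
  intro t ht β ⟨hβ0, hβ1⟩
  rcases hβ0.eq_or_lt with rfl | hpos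
  · obtain ⟨x, hx, -⟩ := hb t ht 1 one_pos
    have h0 := ha 0 ⟨le_rfl, hT.le⟩ x hx x hx (by simp) (1 / 2) (by norm_num)
    have := (abs_nonneg _).trans h0
    rw [zero_mul]
    linarith
  · obtain ⟨n, hn⟩ := exists_pow_lt_of_lt_one hpos (show (2 / 3 : ℝ) < 1 by norm_num)
    exact iter n t ht β hn.le hβ1
end

section
/- Let E be a real normed space, f : E → ℝ Fréchet differentiable, and μ : [0, ∞) → ℝ such that for all x, y ∈ E and α ∈ (0,1), |α f(x) + (1−α) f(y) − f(α x + (1−α) y)| ≤ α(1−α) μ(‖x − y‖). Then for all x, y ∈ E: (i) |f(y) − f(x) − ⟨f'(x), y − x⟩| ≤ μ(‖y − x‖), and (ii) |⟨f'(x) − f'(y), x − y⟩| ≤ 2 μ(‖x − y‖). -/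
open Filter Topology in
theorem abs_sub_sub_fderiv_le_of_curvature {E : Type*} [NormedAddCommGroup E] [NormedSpace ℝ E]
    {f : E → ℝ} {L : E →L[ℝ] ℝ} {x y : E} (hf : HasFDerivAt f L x) {C : ℝ}
    (hC : ∀ α ∈ Set.Ioo (0:ℝ) 1,
      |α * f y + (1 - α) * f x - f (α • y + (1 - α) • x)| ≤ α * (1 - α) * C) :
    |f y - f x - L (y - x)| ≤ C := by
  have hline : Tendsto (fun t : ℝ => t⁻¹ • (f (x + t • (y - x)) - f x)) (𝓝[>] 0)
      (𝓝 (L (y - x))) := by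
    simpa using (hf.hasLineDerivAt (y - x)).tendsto_slope_zero_right
  have hlhs := (hline.const_sub (f y - f x)).abs
  have hrhs : Tendsto (fun t : ℝ => (1 - t) * C) (𝓝[>] 0) (𝓝 C) := by
    have h : Continuous fun t : ℝ => (1 - t) * C := by fun_prop
    simpa using (h.tendsto 0).mono_left nhdsWithin_le_nhds
  refine le_of_tendsto_of_tendsto hlhs hrhs ?_
  filter_upwards [Ioo_mem_nhdsGT (zero_lt_one (α := ℝ))] with t ht
  have ht0 : 0 < t := ht.1
  have hpoint : t • y + (1 - t) • x = x + t • (y - x) := by module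
  have key := hC t ht
  rw [hpoint] at key
  have hfactor : t * f y + (1 - t) * f x - f (x + t • (y - x)) =
      t * (f y - f x - t⁻¹ • (f (x + t • (y - x)) - f x)) := by
    rw [smul_eq_mul]
    field_simp
    ring
  rw [hfactor, abs_mul, abs_of_pos ht0, mul_assoc] at key
  exact le_of_mul_le_mul_left key ht0

theorem stmt_3 {E : Type*} [NormedAddCommGroup E] [NormedSpace ℝ E]
    (f : E → ℝ) (f' : E → E →L[ℝ] ℝ) (hf : ∀ x, HasFDerivAt f (f' x) x)
    (μ : ℝ → ℝ)
    (hcurv : ∀ x y : E, ∀ α ∈ Set.Ioo (0:ℝ) 1,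
      |α * f x + (1 - α) * f y - f (α • x + (1 - α) • y)| ≤ α * (1 - α) * μ ‖x - y‖) :
    ∀ x y : E,
      |f y - f x - f' x (y - x)| ≤ μ ‖y - x‖ ∧
      |(f' x - f' y) (x - y)| ≤ 2 * μ ‖x - y‖ := by
  intro x y
  have hxy := abs_sub_sub_fderiv_le_of_curvature (hf x) (hcurv y x)
  have hyx := abs_sub_sub_fderiv_le_of_curvature (hf y) (hcurv x y)
  refine ⟨hxy, ?_⟩
  rw [norm_sub_rev] at hxy
  rw [abs_le] at hxy hyx ⊢
  simp only [sub_apply, map_sub] at hxy hyx ⊢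
  constructor <;> linarith [hxy.1, hxy.2, hyx.1, hyx.2]
end

section
/- Let E be a real normed space, f : E → ℝ Fréchet differentiable, and μ : [0, ∞) → ℝ nonnegative with the upper curvature property for f, such that τ ↦ μ(τ)/τ is integrable on (0, r] for every r > 0. Define σ(r) = ∫₀^r μ(τ)/τ dτ. Then for all x, y ∈ E, |f(y) − f(x) − ⟨f'(x), y − x⟩| ≤ 2 σ(‖x − y‖). -/
theorem abs_sub_sub_fderiv_le_of_upperCurvature {E : Type*} [NormedAddCommGroup E]
    [NormedSpace ℝ E] {f : E → ℝ} {L : E →L[ℝ] ℝ} {x y : E} {c : ℝ}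
    (hf : HasFDerivAt f L x) (hc : 0 ≤ c)
    (hcurv : ∀ α ∈ Set.Ioo (0:ℝ) 1,
      |α * f x + (1 - α) * f y - f (α • x + (1 - α) • y)| ≤ α * (1 - α) * c) :
    |f y - f x - L (y - x)| ≤ c := by
  have hline : HasDerivAt (fun t : ℝ => f (x + t • (y - x))) (L (y - x)) 0 := by
    have hx : HasFDerivAt f L (x + (0:ℝ) • (y - x)) := by simpa using hf
    have hl : HasDerivAt (fun t : ℝ => x + t • (y - x)) (y - x) 0 := by
      simpa using ((hasDerivAt_id (0:ℝ)).smul_const (y - x)).const_add x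
    exact hx.comp_hasDerivAt 0 hl
  have hlim := ((hline.tendsto_slope_zero_right).const_sub (f y - f x)).abs
  refine le_of_tendsto hlim ?_
  filter_upwards [Ioo_mem_nhdsGT (zero_lt_one' ℝ)] with β hβ
  have h := hcurv (1 - β) ⟨by linarith [hβ.2], by linarith [hβ.1]⟩
  have hpt : (1 - β) • x + (1 - (1 - β)) • y = x + β • (y - x) := by module
  rw [hpt] at h
  have hβ0 : β ≠ 0 := hβ.1.ne'
  simp only [zero_add, zero_smul, add_zero, smul_eq_mul]
  have heq : (1 - β) * f x + (1 - (1 - β)) * f y - f (x + β • (y - x))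
      = β * (f y - f x - β⁻¹ * (f (x + β • (y - x)) - f x)) := by
    field_simp
    ring
  rw [heq, abs_mul, abs_of_pos hβ.1] at h
  refine le_of_mul_le_mul_left (h.trans ?_) hβ.1
  nlinarith [mul_nonneg (mul_self_nonneg β) hc]


theorem stmt_4 {E : Type*} [NormedAddCommGroup E] [NormedSpace ℝ E]
    (f : E → ℝ) (f' : E → E →L[ℝ] ℝ) (hf : ∀ x, HasFDerivAt f (f' x) x)
    (μ : ℝ → ℝ) (hμ0 : ∀ t ≥ (0:ℝ), 0 ≤ μ t)
    (hcurv : ∀ x y : E, ∀ α ∈ Set.Ioo (0:ℝ) 1,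
      |α * f x + (1 - α) * f y - f (α • x + (1 - α) • y)| ≤ α * (1 - α) * μ ‖x - y‖)
    (hint : ∀ r > (0:ℝ), IntervalIntegrable (fun τ => μ τ / τ) MeasureTheory.volume 0 r) :
    ∀ x y : E,
      |f y - f x - f' x (y - x)| ≤ 2 * ∫ τ in (0:ℝ)..‖x - y‖, μ τ / τ := by
  intro x y
  rcases eq_or_ne x y with rfl | hxy
  · simp
  have htaylor : ∀ a b, |f b - f a - f' a (b - a)| ≤ μ ‖a - b‖ := fun a b =>
    abs_sub_sub_fderiv_le_of_upperCurvature (hf a) (hμ0 _ (norm_nonneg _)) (hcurv a b)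
  set r := ‖x - y‖ with hr
  have hr0 : 0 < r := norm_pos_iff.2 (sub_ne_zero.2 hxy)
  obtain ⟨u, hu⟩ : ∃ u, u = r⁻¹ • (y - x) := ⟨_, rfl⟩
  have hu1 : ‖u‖ = 1 := by
    rw [hu, norm_smul, norm_inv, Real.norm_of_nonneg hr0.le, norm_sub_rev y x, ← hr,
      inv_mul_cancel₀ hr0.ne']
  have hru : r • u = y - x := by rw [hu, smul_inv_smul₀ hr0.ne']
  have hderiv : ∀ t : ℝ, HasDerivAt (fun t : ℝ => f (x + t • u) - t * f' x u)
      (f' (x + t • u) u - f' x u) t := by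
    intro t
    have hl : HasDerivAt (fun t : ℝ => x + t • u) u t := by
      simpa using ((hasDerivAt_id t).smul_const u).const_add x
    exact ((hf (x + t • u)).comp_hasDerivAt t hl).sub
      (by simpa using (hasDerivAt_id t).mul_const (f' x u))
  have hbound : ∀ t ∈ Set.Ioo 0 r, |f' (x + t • u) u - f' x u| ≤ 2 * (μ t / t) := by
    intro t ht
    have h1 := htaylor x (x + t • u)
    have h2 := htaylor (x + t • u) x
    have hn : ‖x - (x + t • u)‖ = t := by
      rw [sub_add_cancel_left, norm_neg, norm_smul, hu1, mul_one, Real.norm_of_nonneg ht.1.le]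
    rw [hn, add_sub_cancel_left, map_smul, smul_eq_mul] at h1
    rw [norm_sub_rev, hn, sub_add_cancel_left, map_neg, map_smul, smul_eq_mul] at h2
    rw [← mul_div_assoc, le_div_iff₀ ht.1, ← abs_of_pos ht.1, ← abs_mul, abs_of_pos ht.1]
    rw [abs_le] at h1 h2 ⊢
    constructor <;> linarith
  have hint2 : MeasureTheory.IntegrableOn (fun t => 2 * (μ t / t)) (Set.Icc 0 r) :=
    (intervalIntegrable_iff_integrableOn_Icc_of_le hr0.le).1 ((hint r hr0).const_mul 2)
  have hcont : ContinuousOn (fun t : ℝ => f (x + t • u) - t * f' x u) (Set.Icc 0 r) :=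
    fun t _ => (hderiv t).continuousAt.continuousWithinAt
  have hup := intervalIntegral.sub_le_integral_of_hasDeriv_right_of_le hr0.le hcont
    (fun t _ => (hderiv t).hasDerivWithinAt) hint2 (fun t ht => (abs_le.1 (hbound t ht)).2)
  have hlow := intervalIntegral.sub_le_integral_of_hasDeriv_right_of_le hr0.le hcont.neg
    (fun t _ => (hderiv t).neg.hasDerivWithinAt) hint2
    (fun t ht => neg_le.1 (abs_le.1 (hbound t ht)).1)
  have hfr : r * f' x u = f' x (y - x) := by rw [← hru, map_smul, smul_eq_mul]
  simp only [Pi.neg_apply, intervalIntegral.integral_const_mul, hru, hfr, zero_smul,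
    zero_mul, add_zero, add_sub_cancel, sub_zero] at hup hlow
  rw [abs_le]
  constructor <;> linarith
end

section
/- Let E be a real normed space, f : E → ℝ convex, and μ : [0, ∞) → ℝ such that for every t ≥ 0: (a) for all x, y ∈ E with ‖x − y‖ ≤ t and all α ∈ (0,1), α f(x) + (1−α) f(y) − f(α x + (1−α) y) ≤ α(1−α) μ(t); and (b) for every ε > 0 there exist x, y ∈ E with ‖x − y‖ ≤ t and α ∈ (0,1) such that α f(x) + (1−α) f(y) − f(α x + (1−α) y) ≥ α(1−α)(μ(t) − ε). Then for all r ≥ 0 and β ∈ [0,1], μ(β r) ≤ β μ(r). -/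
theorem stmt_6 {E : Type*} [NormedAddCommGroup E] [NormedSpace ℝ E]
    (f : E → ℝ) (hfc : ConvexOn ℝ Set.univ f) (μ : ℝ → ℝ)
    (ha : ∀ t ≥ (0:ℝ), ∀ x y : E, ‖x - y‖ ≤ t → ∀ α ∈ Set.Ioo (0:ℝ) 1,
      α * f x + (1 - α) * f y - f (α • x + (1 - α) • y) ≤ α * (1 - α) * μ t)
    (hb : ∀ t ≥ (0:ℝ), ∀ ε > (0:ℝ), ∃ x y : E, ‖x - y‖ ≤ t ∧
      ∃ α ∈ Set.Ioo (0:ℝ) 1,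
        α * (1 - α) * (μ t - ε) ≤ α * f x + (1 - α) * f y - f (α • x + (1 - α) • y)) :
    ∀ r ≥ (0:ℝ), ∀ β ∈ Set.Icc (0:ℝ) 1, μ (β * r) ≤ β * μ r := by
  rintro r hr β ⟨hβ0, hβ1⟩
  refine le_of_forall_pos_le_add fun ε hε => ?_
  obtain ⟨x, y, hxy, α, ⟨hα0, hα1⟩, h⟩ := hb (β * r) (by positivity) ε hε
  have hpos : 0 < α * (1 - α) := mul_pos hα0 (sub_pos.2 hα1)
  suffices hgap : α * f x + (1 - α) * f y - f (α • x + (1 - α) • y)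
      ≤ α * (1 - α) * (β * μ r) by
    linarith [le_of_mul_le_mul_left (h.trans hgap) hpos]
  rcases hβ0.eq_or_lt with rfl | hβ
  · obtain rfl : x = y := by
      simpa [sub_eq_zero] using hxy
    rw [← add_smul, add_sub_cancel, one_smul]
    exact le_of_eq (by ring)
  -- Dilate the segment by `β⁻¹` about the intermediate point `z`.
  set z := α • x + (1 - α) • y with hz
  have hconv (w : E) : f w ≤ (1 - β) * f z + β * f (z + β⁻¹ • (w - z)) := by
    have hw : (1 - β) • z + β • (z + β⁻¹ • (w - z)) = w := by
      rw [smul_add β, smul_inv_smul₀ hβ.ne']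
      module
    simpa only [hw, smul_eq_mul] using
      hfc.2 (Set.mem_univ z) (Set.mem_univ (z + β⁻¹ • (w - z))) (sub_nonneg.2 hβ1) hβ0
        (sub_add_cancel 1 β)
  have hdist : ‖(z + β⁻¹ • (x - z)) - (z + β⁻¹ • (y - z))‖ ≤ r := by
    rw [add_sub_add_left_eq_sub, ← smul_sub, sub_sub_sub_cancel_right, norm_smul,
      Real.norm_of_nonneg (inv_nonneg.2 hβ0), inv_mul_le_iff₀ hβ]
    exact hxy
  have hcomb : α • (z + β⁻¹ • (x - z)) + (1 - α) • (z + β⁻¹ • (y - z)) = z := by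
    rw [hz]
    module
  have hbig := ha r hr _ _ hdist α ⟨hα0, hα1⟩
  rw [hcomb] at hbig
  have hx := mul_le_mul_of_nonneg_left (hconv x) hα0.le
  have hy := mul_le_mul_of_nonneg_left (hconv y) (sub_pos.2 hα1).le
  have hscaled := mul_le_mul_of_nonneg_left hbig hβ0
  linarith
end

section
/- Let μ : [0, ∞) → ℝ be nonnegative, with τ ↦ μ(τ)/τ integrable on (0, r] for every r > 0, and satisfying the growth condition μ(β t) ≥ β² μ(t) for all t ≥ 0 and β ∈ [0,1]. Define σ(r) = ∫₀^r μ(τ)/τ dτ. Then the function ξ(τ) = σ(√τ) is concave on [0, ∞). -/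
/-- If `μ t / t ^ 2` is nonincreasing, then the primitive of `μ s / s` lies below its tangent
parabola at every positive point. -/
theorem integral_div_self_sub_le_of_growth {μ : ℝ → ℝ}
    (hint : ∀ r > (0:ℝ), IntervalIntegrable (fun τ => μ τ / τ) MeasureTheory.volume 0 r)
    (hgrow : ∀ t ≥ (0:ℝ), ∀ β ∈ Set.Icc (0:ℝ) 1, β ^ 2 * μ t ≤ μ (β * t))
    {c r : ℝ} (hc : 0 < c) (hr : 0 ≤ r) :
    (∫ s in (0:ℝ)..r, μ s / s) - ∫ s in (0:ℝ)..c, μ s / s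
      ≤ μ c / c ^ 2 * ((r ^ 2 - c ^ 2) / 2) := by
  have hint' : ∀ r ≥ (0:ℝ), IntervalIntegrable (fun τ => μ τ / τ) MeasureTheory.volume 0 r := by
    intro r hr
    rcases hr.lt_or_eq with h | h
    · exact hint r h
    · rw [← h]
  have key : ∀ s t : ℝ, 0 < s → s ≤ t → s ^ 2 * μ t ≤ t ^ 2 * μ s := by
    intro s t hs hst
    have ht : 0 < t := hs.trans_le hst
    have h := hgrow t ht.le (s / t) ⟨by positivity, (div_le_one ht).2 hst⟩
    rw [div_mul_cancel₀ _ ht.ne', div_pow, div_mul_eq_mul_div, div_le_iff₀ (by positivity)] at h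
    linarith
  have hlin : ∀ a b : ℝ, IntervalIntegrable (fun s : ℝ => μ c / c ^ 2 * s)
      MeasureTheory.volume a b := fun a b =>
    (continuous_const.mul continuous_id).intervalIntegrable a b
  have hval : ∀ a b : ℝ, ∫ s in a..b, μ c / c ^ 2 * s = μ c / c ^ 2 * ((b ^ 2 - a ^ 2) / 2) := by
    intro a b
    rw [intervalIntegral.integral_const_mul, integral_id]
  rw [intervalIntegral.integral_interval_sub_left (hint' r hr) (hint' c hc.le), ← hval]
  rcases le_total c r with h | h
  · refine intervalIntegral.integral_mono_on h ((hint' c hc.le).symm.trans (hint' r hr))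
      (hlin c r) fun s hs => ?_
    have hs0 : 0 < s := hc.trans_le hs.1
    rw [div_mul_eq_mul_div, div_le_div_iff₀ hs0 (by positivity)]
    nlinarith [key c s hc hs.1]
  · rw [intervalIntegral.integral_symm, intervalIntegral.integral_symm r c, neg_le_neg_iff]
    refine intervalIntegral.integral_mono_on_of_le_Ioo h (hlin r c)
      ((hint' r hr).symm.trans (hint' c hc.le)) fun s hs => ?_
    have hs0 : 0 < s := hr.trans_lt hs.1
    rw [div_mul_eq_mul_div, div_le_div_iff₀ (by positivity) hs0]
    nlinarith [key s c hs0 hs.2.le]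

theorem stmt_8 (μ : ℝ → ℝ) (hμ0 : ∀ t ≥ (0:ℝ), 0 ≤ μ t)
    (hint : ∀ r > (0:ℝ), IntervalIntegrable (fun τ => μ τ / τ) MeasureTheory.volume 0 r)
    (hgrow : ∀ t ≥ (0:ℝ), ∀ β ∈ Set.Icc (0:ℝ) 1, β^2 * μ t ≤ μ (β * t)) :
    ConcaveOn ℝ (Set.Ici (0:ℝ)) (fun τ => ∫ s in (0:ℝ)..Real.sqrt τ, μ s / s) := by
  rw [concaveOn_iff_forall_pos]
  refine ⟨convex_Ici 0, fun x hx y hy a b ha hb hab => ?_⟩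
  rw [Set.mem_Ici] at hx hy
  simp only [smul_eq_mul]
  have hz : 0 ≤ a * x + b * y := by positivity
  rcases hz.lt_or_eq with hz' | hz'
  · have hc := Real.sqrt_pos.2 hz'
    have h1 := integral_div_self_sub_le_of_growth hint hgrow hc (Real.sqrt_nonneg x)
    have h2 := integral_div_self_sub_le_of_growth hint hgrow hc (Real.sqrt_nonneg y)
    rw [Real.sq_sqrt hz, Real.sq_sqrt hx] at h1
    rw [Real.sq_sqrt hz, Real.sq_sqrt hy] at h2
    obtain rfl : b = 1 - a := by linarith
    linear_combination a * h1 + (1 - a) * h2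
  · have hx0 : x = 0 := by nlinarith [mul_nonneg ha.le hx, mul_nonneg hb.le hy]
    have hy0 : y = 0 := by nlinarith [mul_nonneg ha.le hx, mul_nonneg hb.le hy]
    simp [hx0, hy0]
end

section
/- Let μ : [0, ∞) → ℝ be nonnegative, with τ ↦ μ(τ)/τ integrable on (0, r] for every r > 0, and satisfying the growth condition μ(β t) ≥ β² μ(t) for all t ≥ 0 and β ∈ [0,1]. Define σ(r) = ∫₀^r μ(τ)/τ dτ. Then for every r > 0 and every t ≥ 0, σ(t) ≤ σ(r) − (1/2) μ(r) + (1/2)(t/r)² μ(r). -/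
theorem stmt_9 (μ : ℝ → ℝ) (hμ0 : ∀ t ≥ (0:ℝ), 0 ≤ μ t)
    (hint : ∀ r > (0:ℝ), IntervalIntegrable (fun τ => μ τ / τ) MeasureTheory.volume 0 r)
    (hgrow : ∀ t ≥ (0:ℝ), ∀ β ∈ Set.Icc (0:ℝ) 1, β^2 * μ t ≤ μ (β * t)) :
    ∀ r > (0:ℝ), ∀ t ≥ (0:ℝ),
      (∫ τ in (0:ℝ)..t, μ τ / τ)
        ≤ (∫ τ in (0:ℝ)..r, μ τ / τ) - (1/2) * μ r + (1/2) * (t / r)^2 * μ r := by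
  intro r hr t ht
  have scaling : ∀ s u : ℝ, 0 ≤ s → s ≤ u → 0 < u → s ^ 2 * μ u ≤ u ^ 2 * μ s := by
    intro s u hs hsu hu
    have h := hgrow u hu.le (s / u) ⟨by positivity, (div_le_one hu).2 hsu⟩
    rw [div_mul_cancel₀ _ hu.ne', div_pow, div_mul_eq_mul_div, div_le_iff₀ (by positivity)] at h
    linarith
  have hint0 : IntervalIntegrable (fun τ => μ τ / τ) MeasureTheory.volume 0 t := by
    rcases ht.eq_or_lt with rfl | ht'
    · exact IntervalIntegrable.refl
    · exact hint t ht'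
  have hlin : ∀ a b : ℝ,
      IntervalIntegrable (fun τ => μ r / r ^ 2 * τ) MeasureTheory.volume a b := fun a b =>
    (by fun_prop : Continuous fun τ => μ r / r ^ 2 * τ).intervalIntegrable a b
  have key : (∫ τ in r..t, μ τ / τ) ≤ ∫ τ in r..t, μ r / r ^ 2 * τ := by
    rcases le_total r t with hrt | htr
    · refine intervalIntegral.integral_mono_on hrt ((hint r hr).symm.trans hint0) (hlin r t) ?_
      rintro τ ⟨hτ, -⟩
      have hτ0 : 0 < τ := hr.trans_le hτ
      have h := scaling r τ hr.le hτ hτ0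
      rw [div_mul_eq_mul_div, div_le_div_iff₀ hτ0 (by positivity)]
      linarith
    · rw [intervalIntegral.integral_symm, intervalIntegral.integral_symm t r, neg_le_neg_iff]
      refine intervalIntegral.integral_mono_on htr (hlin t r) (hint0.symm.trans (hint r hr)) ?_
      rintro τ ⟨hτ, hτr⟩
      rcases (ht.trans hτ).eq_or_lt with rfl | hτ0
      · simp
      · have h := scaling τ r hτ0.le hτr hr
        rw [div_mul_eq_mul_div, div_le_div_iff₀ (by positivity) hτ0]
        linarith
  have hsub := intervalIntegral.integral_interval_sub_left hint0 (hint r hr)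
  rw [intervalIntegral.integral_const_mul, integral_id] at key
  have hval : μ r / r ^ 2 * ((t ^ 2 - r ^ 2) / 2) =
      (1/2) * (t / r)^2 * μ r - (1/2) * μ r := by
    field_simp
  linarith
end

section
/- Let r₀ ∈ ℝ, let Γ ⊆ ℝ be an interval of the form [0, D] or [0, ∞) containing r₀, let ψ : Γ → ℝ, and let a, b > 0. Suppose that for every r ∈ Γ with r ≥ r₀ and every α ∈ [0, b] with r + α ∈ Γ, ψ(r + α) ≥ ψ(r) − a α². Then ψ(r) ≥ ψ(r₀) for every r ∈ Γ with r ≥ r₀. -/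
/-- Iterating a bound with quadratic error along equal steps accumulates the error linearly. -/
lemma sub_mul_sq_le_of_step {Γ : Set ℝ} (hΓ : Γ.OrdConnected) {r₀ : ℝ} (hr₀ : r₀ ∈ Γ)
    {ψ : ℝ → ℝ} {a b : ℝ}
    (h : ∀ r ∈ Γ, r₀ ≤ r → ∀ α ∈ Set.Icc (0:ℝ) b, r + α ∈ Γ → ψ r - a * α^2 ≤ ψ (r + α))
    {δ : ℝ} (hδ : δ ∈ Set.Icc 0 b) (n : ℕ) (hn : r₀ + n * δ ∈ Γ) :
    ψ r₀ - n * (a * δ^2) ≤ ψ (r₀ + n * δ) := by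
  induction n with
  | zero => simp
  | succ n ih =>
    have h0 : 0 ≤ (n : ℝ) * δ := mul_nonneg n.cast_nonneg hδ.1
    have heq : r₀ + ((n + 1 : ℕ) : ℝ) * δ = r₀ + n * δ + δ := by push_cast; ring
    rw [heq] at hn ⊢
    have hmem : r₀ + n * δ ∈ Γ := hΓ.out hr₀ hn ⟨by linarith, by linarith [hδ.1]⟩
    have hstep := h _ hmem (by linarith) δ hδ hn
    have := ih hmem
    push_cast
    linarith

/-- A function on an order-connected set whose decrease over small increments is at most quadratic
stays above its initial value. -/
lemma le_of_forall_sub_sq_le {Γ : Set ℝ} (hΓ : Γ.OrdConnected) {r₀ : ℝ} (hr₀ : r₀ ∈ Γ)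
    {ψ : ℝ → ℝ} {a b : ℝ} (hb : 0 < b)
    (h : ∀ r ∈ Γ, r₀ ≤ r → ∀ α ∈ Set.Icc (0:ℝ) b, r + α ∈ Γ → ψ r - a * α^2 ≤ ψ (r + α))
    {r : ℝ} (hr : r ∈ Γ) (hle : r₀ ≤ r) : ψ r₀ ≤ ψ r := by
  have hlim : Filter.Tendsto (fun n : ℕ => ψ r₀ - a * (r - r₀)^2 / n) Filter.atTop
      (nhds (ψ r₀)) := by
    simpa using (tendsto_const_div_atTop_nhds_zero_nat (a * (r - r₀)^2)).const_sub (ψ r₀)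
  refine le_of_tendsto hlim ?_
  filter_upwards [Filter.eventually_ge_atTop ⌈(r - r₀) / b⌉₊, Filter.eventually_gt_atTop 0]
    with n hn hpos
  have hn0 : (0 : ℝ) < n := Nat.cast_pos.2 hpos
  have hδ : (r - r₀) / n ∈ Set.Icc 0 b :=
    ⟨div_nonneg (sub_nonneg.2 hle) hn0.le, (div_le_comm₀ hb hn0).1 (Nat.ceil_le.1 hn)⟩
  have heq : r₀ + n * ((r - r₀) / n) = r := by field_simp; ring
  have key := sub_mul_sq_le_of_step hΓ hr₀ h hδ n (heq.symm ▸ hr)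
  have herr : n * (a * ((r - r₀) / n)^2) = a * (r - r₀)^2 / n := by field_simp
  rwa [heq, herr] at key

theorem stmt_11 (Γ : Set ℝ) (hΓ : (∃ D : ℝ, Γ = Set.Icc 0 D) ∨ Γ = Set.Ici 0)
    (r₀ : ℝ) (hr₀ : r₀ ∈ Γ) (ψ : ℝ → ℝ) (a b : ℝ) (ha : 0 < a) (hb : 0 < b)
    (h : ∀ r ∈ Γ, r₀ ≤ r → ∀ α ∈ Set.Icc (0:ℝ) b, r + α ∈ Γ →
      ψ r - a * α^2 ≤ ψ (r + α)) :
    ∀ r ∈ Γ, r₀ ≤ r → ψ r₀ ≤ ψ r := by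
  have hconn : Γ.OrdConnected := by
    rcases hΓ with ⟨D, rfl⟩ | rfl
    · exact Set.ordConnected_Icc
    · exact Set.ordConnected_Ici
  exact fun r hr hle => le_of_forall_sub_sq_le hconn hr₀ hb h hr hle
end

section
/- Let μ : [0, ∞) → ℝ be nonnegative, with τ ↦ μ(τ)/τ integrable on (0, r] for every r > 0, and satisfying the growth condition μ(β t) ≥ β² μ(t) for all t ≥ 0 and β ∈ [0,1]. Define σ(r) = ∫₀^r μ(τ)/τ dτ, δ⁺(r) = 2σ(r) − μ(r), and L(r) = (2/r²) μ(r). Then δ⁺ is nondecreasing on [0, ∞), and L is nonincreasing on (0, ∞). -/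
theorem sq_div_sq_mul_le_of_growth {μ : ℝ → ℝ}
    (hgrow : ∀ t ≥ (0:ℝ), ∀ β ∈ Set.Icc (0:ℝ) 1, β^2 * μ t ≤ μ (β * t))
    {a b : ℝ} (ha : 0 ≤ a) (hb : 0 < b) (hab : a ≤ b) : a^2 / b^2 * μ b ≤ μ a := by
  have h := hgrow b hb.le (a / b) ⟨by positivity, (div_le_one hb).2 hab⟩
  rwa [div_mul_cancel₀ a hb.ne', div_pow] at h

theorem sub_le_two_mul_integral_of_growth {μ : ℝ → ℝ}
    (hint : ∀ r > (0:ℝ), IntervalIntegrable (fun τ => μ τ / τ) MeasureTheory.volume 0 r)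
    (hgrow : ∀ t ≥ (0:ℝ), ∀ β ∈ Set.Icc (0:ℝ) 1, β^2 * μ t ≤ μ (β * t))
    {a b : ℝ} (ha : 0 ≤ a) (hb : 0 < b) (hab : a ≤ b) :
    μ b - a^2 / b^2 * μ b ≤ 2 * ∫ τ in a..b, μ τ / τ := by
  have hI : IntervalIntegrable (fun τ => μ τ / τ) MeasureTheory.volume a b :=
    (hint b hb).mono_set (by
      rw [Set.uIcc_of_le hab, Set.uIcc_of_le hb.le]
      exact Set.Icc_subset_Icc_left ha)
  have hle : ∫ τ in a..b, τ * (μ b / b^2) ≤ ∫ τ in a..b, μ τ / τ := by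
    refine intervalIntegral.integral_mono_on hab
      (Continuous.intervalIntegrable (by fun_prop) a b) hI fun τ hτ => ?_
    rcases (ha.trans hτ.1).eq_or_lt with rfl | h0
    · simp
    · rw [le_div_iff₀ h0]
      calc τ * (μ b / b^2) * τ = τ^2 / b^2 * μ b := by ring
        _ ≤ μ τ := sq_div_sq_mul_le_of_growth hgrow h0.le hb hτ.2
  rw [intervalIntegral.integral_mul_const, integral_id] at hle
  calc μ b - a^2 / b^2 * μ b = 2 * ((b^2 - a^2) / 2 * (μ b / b^2)) := by field_simp
    _ ≤ _ := by gcongr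

theorem stmt_12 (μ : ℝ → ℝ) (hμ0 : ∀ t ≥ (0:ℝ), 0 ≤ μ t)
    (hint : ∀ r > (0:ℝ), IntervalIntegrable (fun τ => μ τ / τ) MeasureTheory.volume 0 r)
    (hgrow : ∀ t ≥ (0:ℝ), ∀ β ∈ Set.Icc (0:ℝ) 1, β^2 * μ t ≤ μ (β * t)) :
    MonotoneOn (fun r => 2 * (∫ τ in (0:ℝ)..r, μ τ / τ) - μ r) (Set.Ici (0:ℝ)) ∧
    AntitoneOn (fun r => (2 / r^2) * μ r) (Set.Ioi (0:ℝ)) := by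
  constructor
  · intro a ha b _ hab
    rw [Set.mem_Ici] at ha
    rcases hab.eq_or_lt with rfl | hlt
    · exact le_rfl
    have hb : 0 < b := ha.trans_lt hlt
    have hIa : IntervalIntegrable (fun τ => μ τ / τ) MeasureTheory.volume 0 a := by
      rcases ha.eq_or_lt with rfl | h0
      · exact IntervalIntegrable.refl
      · exact hint a h0
    have hsub := intervalIntegral.integral_interval_sub_left (hint b hb) hIa
    have hσ := sub_le_two_mul_integral_of_growth hint hgrow ha hb hab
    have hμ := sq_div_sq_mul_le_of_growth hgrow ha hb hab
    simp only
    linarith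
  · intro a ha b hb hab
    rw [Set.mem_Ioi] at ha hb
    have h := sq_div_sq_mul_le_of_growth hgrow ha.le hb hab
    calc 2 / b^2 * μ b = 2 / a^2 * (a^2 / b^2 * μ b) := by field_simp
      _ ≤ 2 / a^2 * μ a := by gcongr
end

section
/- Let H be a real inner product space, Q ⊆ H a convex set, f : H → ℝ Fréchet differentiable, M > 0, and ε > 0. Assume that for all x, y ∈ H, |f(y) − f(x) − ⟨∇f(x), y − x⟩| ≤ (1/2) M ‖y − x‖² + ε/2. Let x̄ ∈ Q and let T ∈ Q satisfy the variational inequality ⟨∇f(x̄) + M(T − x̄), x − T⟩ ≥ 0 for all x ∈ Q. Then for every x ∈ Q, ⟨∇f(T), x − T⟩ ≥ −(3/2)ε − 2M ‖x̄ − T‖² − 2M ‖x − T‖². -/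
open RealInnerProductSpace

theorem stmt_15 {H : Type*} [NormedAddCommGroup H] [InnerProductSpace ℝ H]
    [CompleteSpace H]
    (Q : Set H) (hQ : Convex ℝ Q)
    (f : H → ℝ) (g : H → H) (hf : ∀ z, HasGradientAt f (g z) z)
    (M ε : ℝ) (hM : 0 < M) (hε : 0 < ε)
    (hbound : ∀ x y : H, |f y - f x - ⟪g x, y - x⟫| ≤ (1/2) * M * ‖y - x‖^2 + ε / 2)
    (xb : H) (hxb : xb ∈ Q) (T : H) (hT : T ∈ Q)
    (hvar : ∀ x ∈ Q, 0 ≤ ⟪g xb + M • (T - xb), x - T⟫) :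
    ∀ x ∈ Q, -(3/2) * ε - 2 * M * ‖xb - T‖^2 - 2 * M * ‖x - T‖^2 ≤ ⟪g T, x - T⟫ := by
  intro x hx
  have hTx := (abs_le.mp (hbound T x)).2
  have hax := (abs_le.mp (hbound xb x)).1
  have haT := (abs_le.mp (hbound xb T)).2
  have hv := hvar x hx
  have hsplit : x - xb = (T - xb) + (x - T) := by abel
  rw [inner_add_left, real_inner_smul_left] at hv
  rw [hsplit, inner_add_right, norm_add_sq_real] at hax
  rw [norm_sub_rev xb T]
  have hsq : 2 * ⟪T - xb, x - T⟫ ≤ ‖T - xb‖ ^ 2 + ‖x - T‖ ^ 2 := by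
    have := norm_sub_sq_real (T - xb) (x - T)
    linarith [sq_nonneg ‖T - xb - (x - T)‖]
  have hMsq := mul_le_mul_of_nonneg_left hsq hM.le
  linarith
end

section
/- Let E be a real normed space, f : E → ℝ convex and Fréchet differentiable, and μ : [0, ∞) → ℝ nonnegative with the upper curvature property for f, satisfying both the growth condition μ(β t) ≥ β² μ(t) and the condition μ(β t) ≤ β μ(t) for all t ≥ 0 and β ∈ [0,1], and such that τ ↦ μ(τ)/τ is integrable on (0, r] for every r > 0. Let ε > 0 and r > 0 satisfy μ(r) = ε/2, and let M ≥ ε/r². Then for all x, y ∈ E, f(y) ≤ f(x) + ⟨f'(x), y − x⟩ + (1/2) M ‖y − x‖² + ε/2. -/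
/-- The upper curvature property bounds the error of the first-order model of `f`. -/
theorem le_add_fderiv_add_of_curvature_bound {E : Type*} [NormedAddCommGroup E] [NormedSpace ℝ E]
    {f : E → ℝ} {x y : E} {L : E →L[ℝ] ℝ} (hf : HasFDerivAt f L x) {c : ℝ} (hc : 0 ≤ c)
    (hcurv : ∀ α ∈ Set.Ioo (0:ℝ) 1,
      α * f x + (1 - α) * f y - f (α • x + (1 - α) • y) ≤ α * (1 - α) * c) :
    f y ≤ f x + L (y - x) + c := by
  have hline : HasDerivAt (fun t : ℝ => f (x + t • (y - x))) (L (y - x)) 0 :=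
    hf.hasLineDerivAt (y - x)
  have hslope := hline.tendsto_slope_zero_right
  have hle : f y - f x - c ≤ L (y - x) := by
    refine ge_of_tendsto hslope ?_
    filter_upwards [Ioo_mem_nhdsGT (zero_lt_one' ℝ)] with t ht
    have h := hcurv (1 - t) ⟨by linarith [ht.2], by linarith [ht.1]⟩
    have hpt : (1 - t) • x + (1 - (1 - t)) • y = x + t • (y - x) := by module
    rw [hpt] at h
    simp only [zero_add, zero_smul, add_zero, smul_eq_mul]
    rw [inv_mul_eq_div, le_div_iff₀ ht.1]
    nlinarith [mul_nonneg (sq_nonneg t) hc]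
  linarith


theorem stmt_16 {E : Type*} [NormedAddCommGroup E] [NormedSpace ℝ E]
    (f : E → ℝ) (hfc : ConvexOn ℝ Set.univ f)
    (f' : E → E →L[ℝ] ℝ) (hf : ∀ x, HasFDerivAt f (f' x) x)
    (μ : ℝ → ℝ) (hμ0 : ∀ t ≥ (0:ℝ), 0 ≤ μ t)
    (hcurv : ∀ x y : E, ∀ α ∈ Set.Ioo (0:ℝ) 1,
      |α * f x + (1 - α) * f y - f (α • x + (1 - α) • y)| ≤ α * (1 - α) * μ ‖x - y‖)
    (hgrow : ∀ t ≥ (0:ℝ), ∀ β ∈ Set.Icc (0:ℝ) 1, β^2 * μ t ≤ μ (β * t))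
    (hsub : ∀ t ≥ (0:ℝ), ∀ β ∈ Set.Icc (0:ℝ) 1, μ (β * t) ≤ β * μ t)
    (hint : ∀ r > (0:ℝ), IntervalIntegrable (fun τ => μ τ / τ) MeasureTheory.volume 0 r)
    (ε r M : ℝ) (hε : 0 < ε) (hr : 0 < r)
    (hμr : μ r = ε / 2) (hM : ε / r^2 ≤ M) :
    ∀ x y : E, f y ≤ f x + f' x (y - x) + (1/2) * M * ‖y - x‖^2 + ε / 2 := by
  intro x y
  have hmodel : f y ≤ f x + f' x (y - x) + μ ‖x - y‖ :=
    le_add_fderiv_add_of_curvature_bound (hf x) (hμ0 _ (norm_nonneg _))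
      fun α hα => (abs_le.mp (hcurv x y α hα)).2
  rw [norm_sub_rev] at hmodel
  set t := ‖y - x‖
  have ht : 0 ≤ t := norm_nonneg _
  have hM0 : 0 ≤ M := le_trans (by positivity) hM
  have hquad : 0 ≤ 1 / 2 * M * t ^ 2 := by positivity
  rcases le_total t r with htr | hrt
  · have hβ : t / r ≤ 1 := (div_le_one hr).mpr htr
    have h := hsub r hr.le (t / r) ⟨by positivity, hβ⟩
    rw [div_mul_cancel₀ _ hr.ne', hμr] at h
    nlinarith
  · have htpos : 0 < t := hr.trans_le hrt
    have h := hgrow t ht (r / t) ⟨by positivity, (div_le_one htpos).mpr hrt⟩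
    rw [div_mul_cancel₀ _ htpos.ne', hμr, div_pow, div_mul_eq_mul_div,
      div_le_iff₀ (by positivity)] at h
    have hεM : ε ≤ M * r ^ 2 := (div_le_iff₀ (by positivity)).mp hM
    have hμt : μ t ≤ 1 / 2 * M * t ^ 2 := by
      refine le_of_mul_le_mul_left ?_ (pow_pos hr 2)
      nlinarith [mul_le_mul_of_nonneg_right hεM (sq_nonneg t)]
    linarith
end

section
/- Let E be a real normed space, Q ⊆ E a convex set, f : E → ℝ convex and Fréchet differentiable, Ψ : Q → ℝ convex, and set f̃ = f + Ψ on Q. Let d : E → ℝ be Fréchet differentiable with d(y) ≥ d(x) + ⟨d'(x), y − x⟩ + (1/2)‖y − x‖² for all x, y ∈ Q, and define the Bregman distance β(x, y) = d(y) − d(x) − ⟨d'(x), y − x⟩ (so β(x, y) ≥ (1/2)‖y − x‖² and β(x, x) = 0 for x, y ∈ Q). Let ε > 0, x₀ ∈ Q, y₀ = x₀, A₀ = 0, and for each k ≥ 0 let a_{k+1} > 0, L_{k+1} > 0, A_{k+1} = A_k + a_{k+1} with a_{k+1}² L_{k+1} = A_{k+1}, and τ_k = a_{k+1}/A_{k+1}.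 Define φ₀(x) = β(x₀, x) and φ_{k+1}(x) = φ_k(x) + a_{k+1} [ f(x_{k+1}) + ⟨f'(x_{k+1}), x − x_{k+1}⟩ + Ψ(x) ]. Assume for every k ≥ 0: (i) v_k ∈ Q satisfies φ_k(x) ≥ φ_k(v_k) + β(v_k, x) for all x ∈ Q; (ii) x_{k+1} = τ_k v_k + (1 − τ_k) y_k; (iii) x̂_{k+1} ∈ Q minimizes y ↦ β(v_k, y) + a_{k+1}(⟨f'(x_{k+1}), y⟩ + Ψ(y)) over Q; (iv) y_{k+1} = τ_k x̂_{k+1} + (1 − τ_k) y_k; and (v) f(y_{k+1}) ≤ f(x_{k+1}) + ⟨f'(x_{k+1}), y_{k+1} − x_{k+1}⟩ + (L_{k+1}/2)‖y_{k+1} − x_{k+1}‖² + (ε/2) τ_k. Then for every k ≥ 0, A_k ( f̃(y_k) − ε/2 ) ≤ inf_{x ∈ Q} φ_k(x). In particular, for any x* ∈ Q and every k ≥ 0, f̃(y_{k+1}) − f̃(x*) ≤ β(x₀, x*)/A_{k+1} + ε/2. -/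
theorem ConvexOn.add_hasFDerivAt_le {E : Type*} [NormedAddCommGroup E] [NormedSpace ℝ E]
    {f : E → ℝ} {f' : E →L[ℝ] ℝ} {u : E} (hfc : ConvexOn ℝ Set.univ f) (hf : HasFDerivAt f f' u)
    (w : E) : f u + f' (w - u) ≤ f w := by
  have hline : HasDerivAt (fun t : ℝ => f (AffineMap.lineMap u w t)) (f' (w - u)) 0 := by
    refine HasFDerivAt.comp_hasDerivAt (0 : ℝ) ?_ AffineMap.hasDerivAt_lineMap
    simpa using hf
  have hconv : ConvexOn ℝ Set.univ (fun t : ℝ => f (AffineMap.lineMap u w t)) :=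
    hfc.comp_affineMap (AffineMap.lineMap u w)
  have := hconv.le_slope_of_hasDerivAt (Set.mem_univ 0) (Set.mem_univ 1) zero_lt_one hline
  simp only [slope_def_field, AffineMap.lineMap_apply_one, AffineMap.lineMap_apply_zero,
    sub_zero, div_one] at this
  linarith

/-- One step of the accelerated scheme, with `p`, `q` the previous and new iterates, `r` the
point of linearization with slope `g`, `s` the previous Bregman minimizer and `t` the new trial
point. -/
theorem accelerated_composite_step {E : Type*} [NormedAddCommGroup E] [NormedSpace ℝ E]
    {Q : Set E} {Ψ : E → ℝ} (hΨ : ConvexOn ℝ Q Ψ) (g : E →L[ℝ] ℝ)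
    {p q r s t : E} (hp : p ∈ Q) (ht : t ∈ Q) {A B a L ε fp fq fr : ℝ}
    (hA : 0 ≤ A) (ha : 0 < a) (hB : B = A + a) (hcouple : a ^ 2 * L = B)
    (hr : r = (a / B) • s + (1 - a / B) • p) (hq : q = (a / B) • t + (1 - a / B) • p)
    (hfp : fr + g (p - r) ≤ fp)
    (hfq : fq ≤ fr + g (q - r) + (L / 2) * ‖q - r‖ ^ 2 + (ε / 2) * (a / B)) :
    B * (fq + Ψ q - ε / 2) ≤
      A * (fp + Ψ p - ε / 2) + (1 / 2) * ‖t - s‖ ^ 2 + a * (fr + g (t - r) + Ψ t) := by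
  have hBpos : 0 < B := by linarith
  have hτ : B * (a / B) = a := by field_simp
  have hτ0 : 0 ≤ a / B := by positivity
  have hτ1 : 0 ≤ 1 - a / B := sub_nonneg.2 ((div_le_one hBpos).2 (by linarith))
  have hΨq : Ψ q ≤ (a / B) * Ψ t + (1 - a / B) * Ψ p := by
    rw [hq]; exact hΨ.2 ht hp hτ0 hτ1 (by ring)
  have hnorm : ‖q - r‖ = (a / B) * ‖t - s‖ := by
    have : q - r = (a / B) • (t - s) := by rw [hq, hr]; module
    rw [this, norm_smul, Real.norm_of_nonneg hτ0]
  have hquad : B * ((L / 2) * ‖q - r‖ ^ 2) = (1 / 2) * ‖t - s‖ ^ 2 := by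
    rw [hnorm]
    calc B * ((L / 2) * ((a / B) * ‖t - s‖) ^ 2)
        = (a ^ 2 * L) / B * ((1 / 2) * ‖t - s‖ ^ 2) := by field_simp
      _ = (1 / 2) * ‖t - s‖ ^ 2 := by rw [hcouple, div_self hBpos.ne', one_mul]
  have hg : g (q - r) = (a / B) * g (t - r) + (1 - a / B) * g (p - r) := by
    have : q - r = (a / B) • (t - r) + (1 - a / B) • (p - r) := by rw [hq]; module
    simp [this]
  have hB1 : B * (1 - a / B) = A := by rw [mul_sub, hτ]; linarith
  calc B * (fq + Ψ q - ε / 2)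
      ≤ B * ((fr + ((a / B) * g (t - r) + (1 - a / B) * g (p - r)) + (L / 2) * ‖q - r‖ ^ 2
          + (ε / 2) * (a / B)) + ((a / B) * Ψ t + (1 - a / B) * Ψ p) - ε / 2) := by
        rw [← hg]; gcongr
    _ = (B * (a / B)) * (fr + g (t - r) + Ψ t)
          + (B * (1 - a / B)) * (fr + g (p - r) + Ψ p - ε / 2)
          + B * ((L / 2) * ‖q - r‖ ^ 2) := by ring
    _ = a * (fr + g (t - r) + Ψ t) + A * (fr + g (p - r) + Ψ p - ε / 2)
          + (1 / 2) * ‖t - s‖ ^ 2 := by rw [hτ, hB1, hquad]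
    _ ≤ A * (fp + Ψ p - ε / 2) + (1 / 2) * ‖t - s‖ ^ 2 + a * (fr + g (t - r) + Ψ t) := by
        have : A * (fr + g (p - r) + Ψ p - ε / 2) ≤ A * (fp + Ψ p - ε / 2) := by gcongr
        linarith


theorem stmt_19 {E : Type*} [NormedAddCommGroup E] [NormedSpace ℝ E]
    (Q : Set E) (hQ : Convex ℝ Q)
    (f : E → ℝ) (hfc : ConvexOn ℝ Set.univ f)
    (f' : E → E →L[ℝ] ℝ) (hf : ∀ z, HasFDerivAt f (f' z) z)
    (Ψ : E → ℝ) (hΨ : ConvexOn ℝ Q Ψ)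
    (d : E → ℝ) (d' : E → E →L[ℝ] ℝ) (hd : ∀ z, HasFDerivAt d (d' z) z)
    (hsc : ∀ u ∈ Q, ∀ w ∈ Q, d u + d' u (w - u) + (1/2) * ‖w - u‖^2 ≤ d w)
    (ε : ℝ) (hε : 0 < ε)
    (x y v xh : ℕ → E) (a L A : ℕ → ℝ)
    (hx0 : x 0 ∈ Q) (hy0 : y 0 = x 0) (hA0 : A 0 = 0)
    (ha : ∀ k : ℕ, 0 < a (k+1)) (hL : ∀ k : ℕ, 0 < L (k+1))
    (hA : ∀ k : ℕ, A (k+1) = A k + a (k+1))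
    (hcouple : ∀ k : ℕ, (a (k+1))^2 * L (k+1) = A (k+1))
    (φ : ℕ → E → ℝ)
    (hφ0 : ∀ z : E, φ 0 z = d z - d (x 0) - d' (x 0) (z - x 0))
    (hφs : ∀ (k : ℕ) (z : E), φ (k+1) z
      = φ k z + a (k+1) * (f (x (k+1)) + f' (x (k+1)) (z - x (k+1)) + Ψ z))
    (hvQ : ∀ k : ℕ, v k ∈ Q)
    (hvmin : ∀ k : ℕ, ∀ z ∈ Q,
      φ k (v k) + (d z - d (v k) - d' (v k) (z - v k)) ≤ φ k z)
    (hxs : ∀ k : ℕ, x (k+1)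
      = (a (k+1) / A (k+1)) • v k + (1 - a (k+1) / A (k+1)) • y k)
    (hxhQ : ∀ k : ℕ, xh (k+1) ∈ Q)
    (hxhmin : ∀ k : ℕ, ∀ z ∈ Q,
      (d (xh (k+1)) - d (v k) - d' (v k) (xh (k+1) - v k))
          + a (k+1) * (f' (x (k+1)) (xh (k+1)) + Ψ (xh (k+1)))
        ≤ (d z - d (v k) - d' (v k) (z - v k)) + a (k+1) * (f' (x (k+1)) z + Ψ z))
    (hys : ∀ k : ℕ, y (k+1)
      = (a (k+1) / A (k+1)) • xh (k+1) + (1 - a (k+1) / A (k+1)) • y k)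
    (hrelax : ∀ k : ℕ,
      f (y (k+1)) ≤ f (x (k+1)) + f' (x (k+1)) (y (k+1) - x (k+1))
        + (L (k+1) / 2) * ‖y (k+1) - x (k+1)‖^2 + (ε / 2) * (a (k+1) / A (k+1))) :
    (∀ k : ℕ, ∀ z ∈ Q, A k * ((f (y k) + Ψ (y k)) - ε / 2) ≤ φ k z)
    ∧ (∀ xs ∈ Q, ∀ k : ℕ,
      (f (y (k+1)) + Ψ (y (k+1))) - (f xs + Ψ xs)
        ≤ (d xs - d (x 0) - d' (x 0) (xs - x 0)) / A (k+1) + ε / 2) := by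
  have hA_nonneg : ∀ k, 0 ≤ A k := by
    intro k
    induction k with
    | zero => exact hA0.ge
    | succ k ih => rw [hA]; exact add_nonneg ih (ha k).le
  have hA_pos : ∀ k, 0 < A (k + 1) := fun k => by
    rw [hA]; exact add_pos_of_nonneg_of_pos (hA_nonneg k) (ha k)
  have hyQ : ∀ k, y k ∈ Q := by
    intro k
    induction k with
    | zero => rwa [hy0]
    | succ k ih =>
      rw [hys]
      refine hQ (hxhQ k) ih (div_nonneg (ha k).le (hA_pos k).le) (sub_nonneg.2 ?_) (by ring)
      rw [div_le_one (hA_pos k), hA]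
      linarith [hA_nonneg k]
  have hlower : ∀ k : ℕ, ∀ z ∈ Q, A k * ((f (y k) + Ψ (y k)) - ε / 2) ≤ φ k z := by
    intro k
    induction k with
    | zero =>
      intro z hz
      rw [hA0, zero_mul, hφ0]
      nlinarith [hsc (x 0) hx0 z hz, sq_nonneg ‖z - x 0‖]
    | succ k ih =>
      intro z hz
      have hstep := accelerated_composite_step hΨ (f' (x (k+1))) (hyQ k) (hxhQ k)
        (hA_nonneg k) (ha k) (hA k) (hcouple k) (hxs k) (hys k)
        (hfc.add_hasFDerivAt_le (hf _) _) (hrelax k)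
      have hmin := hxhmin k z hz
      rw [hφs]
      rw [map_sub (f' (x (k+1)))] at hstep ⊢
      linarith [ih (v k) (hvQ k), hvmin k z hz, hsc (v k) (hvQ k) (xh (k+1)) (hxhQ k)]
  have hupper : ∀ k : ℕ, ∀ z, φ k z ≤ φ 0 z + A k * (f z + Ψ z) := by
    intro k z
    induction k with
    | zero => simp [hA0]
    | succ k ih =>
      rw [hφs, hA]
      have := mul_le_mul_of_nonneg_left (hfc.add_hasFDerivAt_le (hf (x (k+1))) z) (ha k).le
      linarith
  refine ⟨hlower, fun xs hxs k => ?_⟩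
  have h := (hlower (k + 1) xs hxs).trans (hupper (k + 1) xs)
  rw [← sub_le_iff_le_add, le_div_iff₀ (hA_pos k), ← hφ0]
  linarith
end
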